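/- Let k>1. For every continuous 2π-periodic function v : ℝ → ℝ² satisfying ∫₀^{2π} v·ω' dt = ∫₀^{2π} v·(1,0) dt = ∫₀^{2π} v·ω dt = 0, there exists a unique C² 2π-periodic function φ : ℝ → ℝ² satisfying the same three orthogonality conditions (∫₀^{2π} φ·ω' dt = ∫₀^{2π} φ·(1,0) dt = ∫₀^{2π} φ·ω dt = 0) and ω₂⁻²𝓙(φ) = v pointwise on ℝ. -/

import Mathlib

open Real MeasureTheory Filter Topology

noncomputable section

/-- Rotation by π/2 in the plane: `iw = (-w₂, w₁)`. -/
def rot (w : ℝ × ℝ) : ℝ × ℝ := (-w.2, w.1)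

/-- The Christoffel-type term `Γ(w) = (2w₁w₂, w₂² - w₁²)`. -/
def Gam (w : ℝ × ℝ) : ℝ × ℝ := (2 * w.1 * w.2, w.2 ^ 2 - w.1 ^ 2)

/-- Euclidean dot product in ℝ². -/
def dotp (v w : ℝ × ℝ) : ℝ := v.1 * w.1 + v.2 * w.2

/-- The hyperbolic length-type functional `L(u) = ((1/2π)∫₀^{2π} u₂⁻²|u'|² dt)^{1/2}`. -/
def hypL (u : ℝ → ℝ × ℝ) : ℝ :=
  Real.sqrt ((1 / (2 * π)) * ∫ t in (0:ℝ)..(2 * π),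
    ((deriv u t).1 ^ 2 + (deriv u t).2 ^ 2) / (u t).2 ^ 2)

/-- `u` is a `K`-loop in the upper half-plane model of the hyperbolic plane:
a nonconstant C² `2π`-periodic curve with values in `H²` solving
`u'' - u₂⁻¹ Γ(u') = L(u) K(u) iu'`. -/
def IsKLoop (K : (ℝ × ℝ) → ℝ) (u : ℝ → ℝ × ℝ) : Prop :=
  ContDiff ℝ 2 u ∧ Function.Periodic u (2 * π) ∧ (∀ t, 0 < (u t).2) ∧
  (¬ ∃ c, ∀ t, u t = c) ∧
  ∀ t, deriv (deriv u) t - ((u t).2)⁻¹ • Gam (deriv u t)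
      = (hypL u * K (u t)) • rot (deriv u t)

/-- A `2π`-periodic curve is embedded if it is injective modulo `2π`. -/
def IsEmbedded (u : ℝ → ℝ × ℝ) : Prop :=
  ∀ t s : ℝ, u t = u s → ∃ n : ℤ, t - s = 2 * π * (n : ℝ)

/-- `R_k = (k² - 1)^{-1/2}`. -/
def Rk (k : ℝ) : ℝ := 1 / Real.sqrt (k ^ 2 - 1)

/-- The reference loop `ω(t) = (cos t, 1/R_k) / (k - sin t)`, a parameterization of the
hyperbolic circle of center `(0,1)` and hyperbolic radius `ρ_k = artanh(1/k)`. -/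
def om (k : ℝ) (t : ℝ) : ℝ × ℝ := (cos t / (k - sin t), (1 / Rk k) / (k - sin t))

/-- The differential `Γ'(w)v = 2(v₂ w - v₁ iw)`. -/
def Gam' (w v : ℝ × ℝ) : ℝ × ℝ := (2 * v.2) • w - (2 * v.1) • rot w

/-- The operator `𝓙`, equal to `ω₂²` times the linearization at `ω` of the
constant-curvature-`k` loop equation:
`𝓙(φ) = -φ'' + kR_k iφ' + ω₂⁻¹Γ'(ω')φ' - ω₂⁻²φ₂Γ(ω') - k²(⨍ ω₂⁻²φ·iω') iω'`. -/
def Jop (k : ℝ) (φ : ℝ → ℝ × ℝ) (t : ℝ) : ℝ × ℝ :=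
  -(deriv (deriv φ) t) + (k * Rk k) • rot (deriv φ t)
    + ((om k t).2)⁻¹ • Gam' (deriv (om k) t) (deriv φ t)
    - ((φ t).2 / (om k t).2 ^ 2) • Gam (deriv (om k) t)
    - (k ^ 2 * ((1 / (2 * π)) * ∫ s in (0:ℝ)..(2 * π),
        dotp (φ s) (rot (deriv (om k) s)) / (om k s).2 ^ 2)) • rot (deriv (om k) t)

/-- The operator `B g = -g'' - kR_k ig' + R_k²(g₂ - k² ⨍ g₂) e₂`. -/
def Bop (k : ℝ) (g : ℝ → ℝ × ℝ) (t : ℝ) : ℝ × ℝ :=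
  -(deriv (deriv g) t) - (k * Rk k) • rot (deriv g t)
    + (Rk k ^ 2 * ((g t).2 - k ^ 2 * ((1 / (2 * π)) * ∫ s in (0:ℝ)..(2 * π), (g s).2)))
        • ((0:ℝ), (1:ℝ))

/-! ### Calculus of plane-valued functions -/

lemma HasDerivAt.fst_comp {g : ℝ → ℝ × ℝ} {g' : ℝ × ℝ} {t : ℝ} (h : HasDerivAt g g' t) :
    HasDerivAt (fun s => (g s).1) g'.1 t :=
  (hasFDerivAt_fst (𝕜 := ℝ) (E := ℝ) (F := ℝ) (p := g t)).comp_hasDerivAt t h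

lemma HasDerivAt.snd_comp {g : ℝ → ℝ × ℝ} {g' : ℝ × ℝ} {t : ℝ} (h : HasDerivAt g g' t) :
    HasDerivAt (fun s => (g s).2) g'.2 t :=
  (hasFDerivAt_snd (𝕜 := ℝ) (E := ℝ) (F := ℝ) (p := g t)).comp_hasDerivAt t h

lemma ContDiff.hasDerivAt_deriv {g : ℝ → ℝ × ℝ} (hg : ContDiff ℝ 2 g) (t : ℝ) :
    HasDerivAt g (deriv g t) t :=
  (hg.differentiable (by norm_num) t).hasDerivAt

lemma ContDiff.contDiff_one_deriv {g : ℝ → ℝ × ℝ} (hg : ContDiff ℝ 2 g) :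
    ContDiff ℝ 1 (deriv g) :=
  ((contDiff_succ_iff_deriv (n := 1)).1 (by simpa [one_add_one_eq_two] using hg)).2.2

lemma ContDiff.hasDerivAt_deriv_deriv {g : ℝ → ℝ × ℝ} (hg : ContDiff ℝ 2 g) (t : ℝ) :
    HasDerivAt (deriv g) (deriv (deriv g) t) t :=
  (hg.contDiff_one_deriv.differentiable (by norm_num) t).hasDerivAt

lemma contDiff_two_of_hasDerivAt {g g' g'' : ℝ → ℝ × ℝ} (h : ∀ t, HasDerivAt g (g' t) t)
    (h' : ∀ t, HasDerivAt g' (g'' t) t) (hc : Continuous g'') : ContDiff ℝ 2 g := by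
  have e : deriv g = g' := funext fun t => (h t).deriv
  have e' : deriv g' = g'' := funext fun t => (h' t).deriv
  have h1 : ContDiff ℝ 1 g' :=
    contDiff_one_iff_deriv.2 ⟨fun t => (h' t).differentiableAt, e' ▸ hc⟩
  have := (contDiff_succ_iff_deriv (𝕜 := ℝ) (n := 1) (f := g)).2
    ⟨fun t => (h t).differentiableAt, by simp, e ▸ h1⟩
  simpa [one_add_one_eq_two] using this

lemma eq_of_hasDerivAt_zero {f : ℝ → ℝ} (h : ∀ t, HasDerivAt f 0 t) (t : ℝ) : f t = f 0 :=
  is_const_of_deriv_eq_zero (fun x => (h x).differentiableAt) (fun x => (h x).deriv) t 0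

lemma hasDerivAt_primitive {f : ℝ → ℝ} (hf : Continuous f) (t : ℝ) :
    HasDerivAt (fun u => ∫ s in (0:ℝ)..u, f s) (f t) t :=
  hf.integral_hasStrictDerivAt 0 t |>.hasDerivAt

lemma periodic_primitive {f : ℝ → ℝ} {T : ℝ} (hf : Continuous f) (hp : Function.Periodic f T)
    (h0 : (∫ s in (0:ℝ)..T, f s) = 0) :
    Function.Periodic (fun u => ∫ s in (0:ℝ)..u, f s) T := by
  intro t
  have h1 := hp.intervalIntegral_add_eq t 0
  have h2 := intervalIntegral.integral_add_adjacent_intervals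
    (hf.intervalIntegrable (μ := volume) 0 t) (hf.intervalIntegrable t (t + T))
  simp only [zero_add] at h1
  simp only [← h2, h1, h0, add_zero]

lemma integral_eq_zero_of_hasDerivAt_periodic {F f : ℝ → ℝ} {T : ℝ}
    (hF : ∀ t, HasDerivAt F (f t) t) (hf : Continuous f) (hp : Function.Periodic F T) :
    (∫ s in (0:ℝ)..T, f s) = 0 := by
  rw [intervalIntegral.integral_eq_sub_of_hasDerivAt (fun t _ => hF t)
    (hf.intervalIntegrable _ _), ← zero_add T, hp 0, sub_self]

/-! ### The reference loop and its moving frame -/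

lemma Rk_pos {k : ℝ} (hk : 1 < k) : 0 < Rk k := by
  have : 0 < k ^ 2 - 1 := by nlinarith
  unfold Rk
  positivity

lemma Rk_sq_mul {k : ℝ} (hk : 1 < k) : Rk k ^ 2 * (k ^ 2 - 1) = 1 := by
  have : 0 < k ^ 2 - 1 := by nlinarith
  unfold Rk
  rw [div_pow, Real.sq_sqrt this.le]
  field_simp

lemma sub_sin_pos {k : ℝ} (hk : 1 < k) (t : ℝ) : 0 < k - sin t := by
  linarith [sin_le_one t]

/-- First component of `ω'`. -/
def velX (k t : ℝ) : ℝ := (1 - k * sin t) / (k - sin t) ^ 2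

/-- Second component of `ω'`. -/
def velY (k t : ℝ) : ℝ := 1 / Rk k * cos t / (k - sin t) ^ 2

/-- The velocity `ω'`. -/
def vel (k t : ℝ) : ℝ × ℝ := (velX k t, velY k t)

/-- Multiplication in `ℂ`, the plane being identified with `ℂ`. -/
def cmul (p g : ℝ × ℝ) : ℝ × ℝ := (g.1 * p.1 - g.2 * p.2, g.1 * p.2 + g.2 * p.1)

lemma hasDerivAt_om {k : ℝ} (hk : 1 < k) (t : ℝ) :
    HasDerivAt (om k) (vel k t) t := by
  have hs := (sub_sin_pos hk t).ne'
  have hd : HasDerivAt (fun t => k - sin t) (-cos t) t := by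
    simpa using (hasDerivAt_sin t).const_sub k
  refine HasDerivAt.prodMk ?_ ?_
  · refine ((hasDerivAt_cos t).div hd hs).congr_deriv ?_
    rw [velX]
    congr 1
    linear_combination sin_sq_add_cos_sq t
  · refine ((hasDerivAt_const t (1 / Rk k)).div hd hs).congr_deriv ?_
    rw [velY]
    ring

lemma deriv_om {k : ℝ} (hk : 1 < k) (t : ℝ) : deriv (om k) t = vel k t :=
  (hasDerivAt_om hk t).deriv

lemma om_snd_inv (k t : ℝ) : ((om k t).2)⁻¹ = Rk k * (k - sin t) := by
  simp [om, mul_comm]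

lemma velocity_normSq {k : ℝ} (hk : 1 < k) (t : ℝ) :
    (k - sin t) ^ 2 * (velX k t ^ 2 + velY k t ^ 2) = 1 := by
  have hs := (sub_sin_pos hk t).ne'
  have hR := (Rk_pos hk).ne'
  have hRR := Rk_sq_mul hk
  rw [velX, velY]
  field_simp
  linear_combination (-cos t ^ 2) * hRR + Rk k ^ 2 * (k ^ 2 - 1) * sin_sq_add_cos_sq t

lemma hasDerivAt_velX {k : ℝ} (hk : 1 < k) (t : ℝ) :
    HasDerivAt (velX k) (Rk k * (k - sin t) * (2 * velX k t * velY k t)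
      - k * Rk k * velY k t) t := by
  have hs := (sub_sin_pos hk t).ne'
  have hR := (Rk_pos hk).ne'
  have hd : HasDerivAt (fun t => k - sin t) (-cos t) t := by
    simpa using (hasDerivAt_sin t).const_sub k
  have hn : HasDerivAt (fun t => 1 - k * sin t) (-(k * cos t)) t := by
    simpa using ((hasDerivAt_sin t).const_mul k).const_sub 1
  refine (hn.div (hd.pow 2) (pow_ne_zero 2 hs)).congr_deriv ?_
  rw [velX, velY]
  simp only [Pi.pow_apply]
  field_simp
  ring

lemma hasDerivAt_velY {k : ℝ} (hk : 1 < k) (t : ℝ) :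
    HasDerivAt (velY k) (Rk k * (k - sin t) * (velY k t ^ 2 - velX k t ^ 2)
      + k * Rk k * velX k t) t := by
  have hs := (sub_sin_pos hk t).ne'
  have hR := (Rk_pos hk).ne'
  have hd : HasDerivAt (fun t => k - sin t) (-cos t) t := by
    simpa using (hasDerivAt_sin t).const_sub k
  have hn : HasDerivAt (fun t => 1 / Rk k * cos t) (1 / Rk k * -sin t) t :=
    (hasDerivAt_cos t).const_mul _
  have hRR := Rk_sq_mul hk
  refine (hn.div (hd.pow 2) (pow_ne_zero 2 hs)).congr_deriv ?_
  rw [velX, velY]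
  simp only [Pi.pow_apply]
  field_simp
  linear_combination (k - sin t) * sin_sq_add_cos_sq t - (k - sin t) * (1 - k * sin t) * hRR

lemma contDiff_velX {k : ℝ} (hk : 1 < k) : ContDiff ℝ 2 (velX k) := by
  unfold velX
  exact ContDiff.div (by fun_prop) (by fun_prop) fun t => pow_ne_zero 2 (sub_sin_pos hk t).ne'

lemma contDiff_velY {k : ℝ} (hk : 1 < k) : ContDiff ℝ 2 (velY k) := by
  unfold velY
  exact ContDiff.div (by fun_prop) (by fun_prop) fun t => pow_ne_zero 2 (sub_sin_pos hk t).ne'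

lemma contDiff_om {k : ℝ} (hk : 1 < k) : ContDiff ℝ 2 (om k) := by
  unfold om
  exact (ContDiff.div (by fun_prop) (by fun_prop) fun t => (sub_sin_pos hk t).ne').prodMk
    (ContDiff.div (by fun_prop) (by fun_prop) fun t => (sub_sin_pos hk t).ne')

lemma contDiff_vel {k : ℝ} (hk : 1 < k) : ContDiff ℝ 2 (vel k) :=
  (contDiff_velX hk).prodMk (contDiff_velY hk)

lemma ContDiff.cmul {p g : ℝ → ℝ × ℝ} (hp : ContDiff ℝ 2 p) (hg : ContDiff ℝ 2 g) :
    ContDiff ℝ 2 fun t => cmul (p t) (g t) := by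
  unfold _root_.cmul
  fun_prop

lemma HasDerivAt.cmul {p g : ℝ → ℝ × ℝ} {p' g' : ℝ × ℝ} {t : ℝ} (hp : HasDerivAt p p' t)
    (hg : HasDerivAt g g' t) :
    HasDerivAt (fun s => cmul (p s) (g s)) (cmul p' (g t) + cmul (p t) g') t := by
  refine (((hg.fst_comp.mul hp.fst_comp).sub (hg.snd_comp.mul hp.snd_comp)).prodMk
    ((hg.fst_comp.mul hp.snd_comp).add (hg.snd_comp.mul hp.fst_comp))).congr_deriv ?_
  ext <;> simp [_root_.cmul] <;> ring

/-- The acceleration `ω''`, expressed through the curvature equation. -/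
def acc (k t : ℝ) : ℝ × ℝ :=
  (Rk k * (k - sin t) * (2 * velX k t * velY k t) - k * Rk k * velY k t,
    Rk k * (k - sin t) * (velY k t ^ 2 - velX k t ^ 2) + k * Rk k * velX k t)

/-- The third derivative `ω'''`, expressed through the curvature equation. -/
def jerk (k t : ℝ) : ℝ × ℝ :=
  (-(Rk k * (k - sin t)) ^ 2 * velY k t * (2 * velX k t * velY k t)
      + Rk k * (k - sin t) * (2 * ((acc k t).1 * velY k t + velX k t * (acc k t).2))
      - k * Rk k * (acc k t).2,
    -(Rk k * (k - sin t)) ^ 2 * velY k t * (velY k t ^ 2 - velX k t ^ 2)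
      + Rk k * (k - sin t) * (2 * (velY k t * (acc k t).2 - velX k t * (acc k t).1))
      + k * Rk k * (acc k t).1)

lemma hasDerivAt_vel {k : ℝ} (hk : 1 < k) (t : ℝ) : HasDerivAt (vel k) (acc k t) t :=
  (hasDerivAt_velX hk t).prodMk (hasDerivAt_velY hk t)

lemma hasDerivAt_acc {k : ℝ} (hk : 1 < k) (t : ℝ) : HasDerivAt (acc k) (jerk k t) t := by
  have hs := (sub_sin_pos hk t).ne'
  have hR := (Rk_pos hk).ne'
  have hw : HasDerivAt (fun t => Rk k * (k - sin t))
      (-(Rk k * (k - sin t)) ^ 2 * velY k t) t := by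
    refine (((hasDerivAt_sin t).const_sub k).const_mul (Rk k)).congr_deriv ?_
    rw [velY]
    field_simp
  have hX : HasDerivAt (velX k) (acc k t).1 t := hasDerivAt_velX hk t
  have hY : HasDerivAt (velY k) (acc k t).2 t := hasDerivAt_velY hk t
  refine (((hw.mul ((hX.const_mul 2).mul hY)).sub (hY.const_mul (k * Rk k))).prodMk
    ((hw.mul ((hY.pow 2).sub (hX.pow 2))).add (hX.const_mul (k * Rk k)))).congr_deriv ?_
  ext
  · simp only [jerk, Pi.mul_apply]
    ring
  · simp only [jerk, Pi.sub_apply, Pi.pow_apply]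
    ring

/-- In the moving frame `(ω', iω')` the operator `𝓙` becomes `B`. -/
lemma Jop_cmul_vel {k : ℝ} (hk : 1 < k) {g : ℝ → ℝ × ℝ} (hg : ContDiff ℝ 2 g) (t : ℝ) :
    Jop k (fun t => cmul (vel k t) (g t)) t = cmul (vel k t) (Bop k g t) := by
  have d1 : deriv (fun t => cmul (vel k t) (g t)) =
      fun t => cmul (acc k t) (g t) + cmul (vel k t) (deriv g t) :=
    funext fun t => ((hasDerivAt_vel hk t).cmul (hg.hasDerivAt_deriv t)).deriv
  have d2 := (((hasDerivAt_acc hk t).cmul (hg.hasDerivAt_deriv t)).add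
    ((hasDerivAt_vel hk t).cmul (hg.hasDerivAt_deriv_deriv t))).deriv
  have hsq : ∀ s, ((om k s).2 ^ 2)⁻¹ * (velX k s ^ 2 + velY k s ^ 2) = Rk k ^ 2 := fun s => by
    rw [← inv_pow, om_snd_inv]
    linear_combination Rk k ^ 2 * velocity_normSq hk s
  have hint : (∫ s in (0:ℝ)..(2 * π), dotp (cmul (vel k s) (g s)) (rot (vel k s)) /
      (om k s).2 ^ 2) = Rk k ^ 2 * ∫ s in (0:ℝ)..(2 * π), (g s).2 := by
    rw [← intervalIntegral.integral_const_mul]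
    congr 1
    ext s
    rw [div_eq_mul_inv]
    simp only [dotp, cmul, rot, vel]
    linear_combination (g s).2 * hsq s
  have h := hsq t
  unfold Jop Bop
  simp only [deriv_om hk, hint]
  rw [d1]
  erw [d2]
  rw [← inv_pow] at h
  simp only [div_eq_mul_inv (b := (om k t).2 ^ 2), ← inv_pow]
  rw [om_snd_inv] at h ⊢
  generalize (∫ s in (0:ℝ)..(2 * π), (g s).2) = I
  ext
  · simp [cmul, vel, rot, Gam, Gam', jerk, acc]
    linear_combination (-velY k t * (g t).2) * h
  · simp [cmul, vel, rot, Gam, Gam', jerk, acc]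
    linear_combination (velX k t * (g t).2) * h

/-! ### Solving `B g = f` -/

lemma bop_fst (k : ℝ) (g : ℝ → ℝ × ℝ) (t : ℝ) :
    (Bop k g t).1 = -(deriv (deriv g) t).1 + k * Rk k * (deriv g t).2 := by
  simp [Bop, rot]

lemma bop_snd (k : ℝ) (g : ℝ → ℝ × ℝ) (t : ℝ) :
    (Bop k g t).2 = -(deriv (deriv g) t).2 - k * Rk k * (deriv g t).1
      + Rk k ^ 2 * ((g t).2 - k ^ 2 * ((1 / (2 * π)) * ∫ s in (0:ℝ)..(2 * π), (g s).2)) := by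
  simp [Bop, rot]

/-- The kernel of `B`; its three parameters correspond to `ω'`, `e₁` and `ω`. -/
def kerB (k x y z t : ℝ) : ℝ × ℝ :=
  (x + y * (1 - k * sin t) + z * (k * cos t), -(y * cos t + z * sin t) / Rk k)

lemma cmul_vel_kerB {k : ℝ} (hk : 1 < k) (x y z t : ℝ) :
    cmul (vel k t) (kerB k x y z t) = x • vel k t + y • ((1:ℝ), (0:ℝ)) + z • om k t := by
  have hs := (sub_sin_pos hk t).ne'
  have hR := (Rk_pos hk).ne'
  have hRR := Rk_sq_mul hk
  have hsc := sin_sq_add_cos_sq t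
  ext
  · simp [cmul, kerB, vel, velX, velY, om]
    field_simp
    linear_combination (-(1 - sin t ^ 2) * y - cos t * sin t * z) * hRR + y * hsc
  · simp [cmul, kerB, vel, velX, velY, om]
    field_simp
    linear_combination k * z * hsc

lemma integral_mul_cos_add_mul_sin (a b : ℝ) :
    (∫ s in (0:ℝ)..(2 * π), (a * cos s + b * sin s)) = 0 := by
  rw [intervalIntegral.integral_add (by apply Continuous.intervalIntegrable; fun_prop)
    (by apply Continuous.intervalIntegrable; fun_prop), intervalIntegral.integral_const_mul,
    intervalIntegral.integral_const_mul, integral_cos, integral_sin]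
  simp

lemma contDiff_kerB (k x y z : ℝ) : ContDiff ℝ 2 (kerB k x y z) := by
  unfold kerB
  fun_prop

lemma Bop_kerB {k : ℝ} (hk : 1 < k) (x y z t : ℝ) : Bop k (kerB k x y z) t = 0 := by
  have hR := (Rk_pos hk).ne'
  have hRR := Rk_sq_mul hk
  have h1 : ∀ t, HasDerivAt (kerB k x y z)
      (-(y * k * cos t + z * k * sin t), (y * sin t - z * cos t) / Rk k) t := fun t => by
    refine ((((((hasDerivAt_sin t).const_mul k).const_sub 1).const_mul y).const_add x |>.add
      (((hasDerivAt_cos t).const_mul k).const_mul z)).prodMk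
      ((((hasDerivAt_cos t).const_mul y).add ((hasDerivAt_sin t).const_mul z)).neg.div_const
        (Rk k))).congr_deriv ?_
    ext <;> dsimp <;> ring
  have h2 : ∀ t, HasDerivAt (fun t => ((-(y * k * cos t + z * k * sin t),
      (y * sin t - z * cos t) / Rk k) : ℝ × ℝ))
      (y * k * sin t - z * k * cos t, (y * cos t + z * sin t) / Rk k) t := fun t => by
    refine ((((hasDerivAt_cos t).const_mul (y * k)).add
      ((hasDerivAt_sin t).const_mul (z * k))).neg.prodMk
      ((((hasDerivAt_sin t).const_mul y).sub ((hasDerivAt_cos t).const_mul z)).div_const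
        (Rk k))).congr_deriv ?_
    ext <;> dsimp <;> ring
  have d1 := funext fun t => (h1 t).deriv
  have d2 := (congrFun (congrArg deriv d1) t).trans (h2 t).deriv
  have hI : (∫ s in (0:ℝ)..(2 * π), (kerB k x y z s).2) = 0 := by
    refine Eq.trans ?_ (integral_mul_cos_add_mul_sin (-y / Rk k) (-z / Rk k))
    congr 1
    ext s
    simp only [kerB]
    ring
  ext
  · rw [bop_fst, d2, d1]
    dsimp
    field_simp
    ring
  · rw [bop_snd, d2, d1, hI]
    simp only [kerB, mul_zero, sub_zero, Prod.snd_zero]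
    field_simp
    linear_combination (y * cos t + z * sin t) * hRR

lemma exists_eq_kerB {k : ℝ} (hk : 1 < k) {g : ℝ → ℝ × ℝ} (hg : ContDiff ℝ 2 g)
    (hp : Function.Periodic g (2 * π)) (h0 : ∀ t, Bop k g t = 0) :
    ∃ x y z, ∀ t, g t = kerB k x y z t := by
  have hR := (Rk_pos hk).ne'
  have hRR := Rk_sq_mul hk
  have hd := hg.hasDerivAt_deriv
  have hdd := hg.hasDerivAt_deriv_deriv
  have e1 := fun t => (bop_fst k g t).symm.trans (congrArg Prod.fst (h0 t))
  have e2 := fun t => (bop_snd k g t).symm.trans (congrArg Prod.snd (h0 t))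
  simp only [Prod.fst_zero, Prod.snd_zero] at e1 e2
  set I := ∫ s in (0:ℝ)..(2 * π), (g s).2 with hI
  obtain ⟨c, hc⟩ : ∃ c, ∀ t, (deriv g t).1 = k * Rk k * (g t).2 - c := by
    have := eq_of_hasDerivAt_zero (f := fun t => k * Rk k * (g t).2 - (deriv g t).1) fun t =>
      (((hd t).snd_comp.const_mul (k * Rk k)).sub (hdd t).fst_comp).congr_deriv
        (by linear_combination e1 t)
    exact ⟨k * Rk k * (g 0).2 - (deriv g 0).1, fun t => by linarith [this t]⟩
  have hg1 : Continuous fun t => (g t).2 := continuous_snd.comp hg.continuous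
  have hcI : c = k * Rk k * ((1 / (2 * π)) * I) := by
    have h1 := integral_eq_zero_of_hasDerivAt_periodic (F := fun t => (g t).1)
      (f := fun t => k * Rk k * (g t).2 - c) (T := 2 * π)
      (fun t => (hd t).fst_comp.congr_deriv (hc t)) (by fun_prop)
      (fun t => by simp only [hp t])
    rw [intervalIntegral.integral_sub (by apply Continuous.intervalIntegrable; fun_prop) (by simp),
      intervalIntegral.integral_const_mul, intervalIntegral.integral_const, ← hI] at h1
    have := pi_pos.ne'
    simp only [sub_zero, smul_eq_mul] at h1
    field_simp
    linarith
  have hosc : ∀ t, (deriv (deriv g) t).2 = -(g t).2 := fun t => by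
    linear_combination -e2 t - k * Rk k * hc t + k * Rk k * hcI - (g t).2 * hRR
  have hA := eq_of_hasDerivAt_zero (f := fun t => (g t).2 * cos t - (deriv g t).2 * sin t)
    fun t => (((hd t).snd_comp.mul (hasDerivAt_cos t)).sub
      ((hdd t).snd_comp.mul (hasDerivAt_sin t))).congr_deriv (by rw [hosc]; ring)
  have hB := eq_of_hasDerivAt_zero (f := fun t => (g t).2 * sin t + (deriv g t).2 * cos t)
    fun t => (((hd t).snd_comp.mul (hasDerivAt_sin t)).add
      ((hdd t).snd_comp.mul (hasDerivAt_cos t))).congr_deriv (by rw [hosc]; ring)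
  simp only [cos_zero, sin_zero, mul_one, mul_zero, sub_zero, zero_add] at hA hB
  set a := (g 0).2
  set b := (deriv g 0).2
  have hg2 : ∀ t, (g t).2 = a * cos t + b * sin t := fun t => by
    linear_combination cos t * hA t + sin t * hB t - (g t).2 * sin_sq_add_cos_sq t
  have hI0 : I = 0 := by
    simp only [hI, hg2]
    exact integral_mul_cos_add_mul_sin a b
  have hC := eq_of_hasDerivAt_zero
    (f := fun t => (g t).1 - k * Rk k * (a * sin t - b * cos t)) fun t =>
      ((hd t).fst_comp.sub ((((hasDerivAt_sin t).const_mul a).sub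
        ((hasDerivAt_cos t).const_mul b)).const_mul (k * Rk k))).congr_deriv (by
          rw [hc, hg2, hcI, hI0]; ring)
  refine ⟨(g 0).1 + k * Rk k * b + Rk k * a, -Rk k * a, -Rk k * b, fun t => ?_⟩
  have := hC t
  simp only [cos_zero, sin_zero] at this
  ext
  · simp only [kerB]
    linear_combination this
  · simp only [kerB, hg2]
    field_simp
    ring

lemma exists_Bop_eq {k : ℝ} (hk : 1 < k) {f : ℝ → ℝ × ℝ} (hf : Continuous f)
    (hp : Function.Periodic f (2 * π)) (h1 : (∫ s in (0:ℝ)..(2 * π), (f s).1) = 0)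
    (h2 : (∫ s in (0:ℝ)..(2 * π), ((f s).2 * cos s + k * Rk k * ((f s).1 * sin s))) = 0)
    (h3 : (∫ s in (0:ℝ)..(2 * π), ((f s).2 * sin s - k * Rk k * ((f s).1 * cos s))) = 0) :
    ∃ g : ℝ → ℝ × ℝ, ContDiff ℝ 2 g ∧ Function.Periodic g (2 * π) ∧ ∀ t, Bop k g t = f t := by
  have hR := (Rk_pos hk).ne'
  have hRR := Rk_sq_mul hk
  have hpi := pi_pos.ne'
  have hf1 : Continuous fun t => (f t).1 := by fun_prop
  have hf2 : Continuous fun t => (f t).2 := by fun_prop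
  obtain ⟨F, hF, hFp, hF0⟩ : ∃ F : ℝ → ℝ, (∀ t, HasDerivAt F (f t).1 t) ∧
      Function.Periodic F (2 * π) ∧ (∫ s in (0:ℝ)..(2 * π), F s) = 0 := by
    set G := fun u => ∫ s in (0:ℝ)..u, (f s).1
    have hG : ∀ t, HasDerivAt G (f t).1 t := hasDerivAt_primitive hf1
    have hGc : Continuous G := continuous_iff_continuousAt.2 fun t => (hG t).continuousAt
    have hGp : Function.Periodic G (2 * π) :=
      periodic_primitive hf1 (fun t => by simp only [hp t]) h1
    refine ⟨fun t => G t - (1 / (2 * π)) * ∫ s in (0:ℝ)..(2 * π), G s,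
      fun t => (hG t).sub_const _, fun t => by simp only [hGp t], ?_⟩
    rw [intervalIntegral.integral_sub (hGc.intervalIntegrable _ _) (by simp),
      intervalIntegral.integral_const]
    simp only [sub_zero, smul_eq_mul]
    field_simp
    ring
  have hFc : Continuous F := continuous_iff_continuousAt.2 fun t => (hF t).continuousAt
  set h : ℝ → ℝ := fun t => (f t).2 - k * Rk k * F t with hh
  have hhc : Continuous h := by fun_prop
  have hhp : Function.Periodic h (2 * π) := fun t => by simp only [hh, hp t, hFp t]
  have hcos : (∫ s in (0:ℝ)..(2 * π), cos s * h s) = 0 := by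
    have hz := integral_eq_zero_of_hasDerivAt_periodic (F := fun t => F t * sin t) (T := 2 * π)
      (fun t => (hF t).mul (hasDerivAt_sin t)) (by fun_prop)
      (fun t => by simp only [hFp t, sin_periodic t])
    have : (fun s => cos s * h s) = fun s => ((f s).2 * cos s + k * Rk k * ((f s).1 * sin s))
        - k * Rk k * ((f s).1 * sin s + F s * cos s) := by
      ext s; simp only [hh]; ring
    rw [this, intervalIntegral.integral_sub (by apply Continuous.intervalIntegrable; fun_prop)
      (by apply Continuous.intervalIntegrable; fun_prop), h2,
      intervalIntegral.integral_const_mul, hz]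
    ring
  have hsin : (∫ s in (0:ℝ)..(2 * π), sin s * h s) = 0 := by
    have hz := integral_eq_zero_of_hasDerivAt_periodic (F := fun t => F t * cos t) (T := 2 * π)
      (fun t => (hF t).mul (hasDerivAt_cos t)) (by fun_prop)
      (fun t => by simp only [hFp t, cos_periodic t])
    have : (fun s => sin s * h s) = fun s => ((f s).2 * sin s - k * Rk k * ((f s).1 * cos s))
        + k * Rk k * ((f s).1 * cos s + F s * -sin s) := by
      ext s; simp only [hh]; ring
    rw [this, intervalIntegral.integral_add (by apply Continuous.intervalIntegrable; fun_prop)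
      (by apply Continuous.intervalIntegrable; fun_prop), h3,
      intervalIntegral.integral_const_mul, hz]
    ring
  set C := fun u => ∫ s in (0:ℝ)..u, cos s * h s
  set S := fun u => ∫ s in (0:ℝ)..u, sin s * h s
  have hC : ∀ t, HasDerivAt C (cos t * h t) t := hasDerivAt_primitive (by fun_prop)
  have hS : ∀ t, HasDerivAt S (sin t * h t) t := hasDerivAt_primitive (by fun_prop)
  have hCp : Function.Periodic C (2 * π) :=
    periodic_primitive (by fun_prop) (fun t => by simp only [hhp t, cos_periodic t]) hcos
  have hSp : Function.Periodic S (2 * π) :=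
    periodic_primitive (by fun_prop) (fun t => by simp only [hhp t, sin_periodic t]) hsin
  have hCc : Continuous C := continuous_iff_continuousAt.2 fun t => (hC t).continuousAt
  have hSc : Continuous S := continuous_iff_continuousAt.2 fun t => (hS t).continuousAt
  set y : ℝ → ℝ := fun t => cos t * S t - sin t * C t with hy
  have hyc : Continuous y := by fun_prop
  have hyp : Function.Periodic y (2 * π) := fun t => by
    simp only [hy, hSp t, hCp t, sin_periodic t, cos_periodic t]
  have hy1 : ∀ t, HasDerivAt y (-(sin t * S t) - cos t * C t) t := fun t =>
    (((hasDerivAt_cos t).mul (hS t)).sub ((hasDerivAt_sin t).mul (hC t))).congr_deriv (by ring)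
  have hy2 : ∀ t, HasDerivAt (fun t => -(sin t * S t) - cos t * C t) (-y t - h t) t := fun t =>
    (((hasDerivAt_sin t).mul (hS t)).neg.sub ((hasDerivAt_cos t).mul (hC t))).congr_deriv (by
      simp only [hy]
      linear_combination (-h t) * sin_sq_add_cos_sq t)
  set m := (1 / (2 * π)) * ∫ s in (0:ℝ)..(2 * π), y s with hm
  have hxc : Continuous fun t => k * Rk k * (y t - m) - F t := by fun_prop
  set x := fun u => ∫ s in (0:ℝ)..u, (k * Rk k * (y s - m) - F s)
  have hx1 : ∀ t, HasDerivAt x (k * Rk k * (y t - m) - F t) t := hasDerivAt_primitive hxc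
  have hxp : Function.Periodic x (2 * π) := by
    refine periodic_primitive hxc (fun t => by simp only [hyp t, hFp t]) ?_
    rw [intervalIntegral.integral_sub (by apply Continuous.intervalIntegrable; fun_prop)
      (hFc.intervalIntegrable _ _), intervalIntegral.integral_const_mul,
      intervalIntegral.integral_sub (hyc.intervalIntegrable _ _) (by simp), hF0,
      intervalIntegral.integral_const, hm]
    simp only [sub_zero, smul_eq_mul]
    field_simp
    ring
  have hx2 : ∀ t, HasDerivAt (fun t => k * Rk k * (y t - m) - F t)
      (k * Rk k * (-(sin t * S t) - cos t * C t) - (f t).1) t := fun t =>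
    (((hy1 t).sub_const m).const_mul _).sub (hF t)
  have hg1 := fun t => (hx1 t).prodMk (hy1 t)
  have hg2 := fun t => (hx2 t).prodMk (hy2 t)
  have d1 := funext fun t => (hg1 t).deriv
  refine ⟨fun t => (x t, y t), contDiff_two_of_hasDerivAt hg1 hg2 (by fun_prop),
    fun t => by simp only [hxp t, hyp t], fun t => ?_⟩
  have d2 := (congrFun (congrArg deriv d1) t).trans (hg2 t).deriv
  ext
  · rw [bop_fst, d2, d1]
    dsimp only
    ring
  · rw [bop_snd, d2, d1]
    dsimp only
    rw [← hm]
    simp only [hh]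
    linear_combination (-y t) * hRR

/-! ### Transfer to `𝓙` -/

lemma vel_periodic (k : ℝ) : Function.Periodic (vel k) (2 * π) := fun t => by
  simp only [vel, velX, velY, sin_periodic t, cos_periodic t]

lemma om_periodic (k : ℝ) : Function.Periodic (om k) (2 * π) := fun t => by
  simp only [om, sin_periodic t, cos_periodic t]

lemma om_snd_pos {k : ℝ} (hk : 1 < k) (t : ℝ) : 0 < (om k t).2 :=
  div_pos (one_div_pos.2 (Rk_pos hk)) (sub_sin_pos hk t)

lemma Continuous.dotp {v w : ℝ → ℝ × ℝ} (hv : Continuous v) (hw : Continuous w) :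
    Continuous fun t => dotp (v t) (w t) := by
  unfold _root_.dotp
  fun_prop

lemma ContDiff.dotp {v w : ℝ → ℝ × ℝ} (hv : ContDiff ℝ 2 v) (hw : ContDiff ℝ 2 w) :
    ContDiff ℝ 2 fun t => dotp (v t) (w t) := by
  unfold _root_.dotp
  fun_prop

lemma ContDiff.rot {w : ℝ → ℝ × ℝ} (hw : ContDiff ℝ 2 w) : ContDiff ℝ 2 fun t => rot (w t) := by
  unfold _root_.rot
  fun_prop

lemma dotp_cmul (v p g : ℝ × ℝ) : dotp v (cmul p g) = g.1 * dotp v p + g.2 * dotp v (rot p) := by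
  simp only [dotp, cmul, rot]
  ring

lemma cmul_dotp_rot (p u : ℝ × ℝ) (c : ℝ) :
    cmul p (c * dotp u p, c * dotp u (rot p)) = (c * (p.1 ^ 2 + p.2 ^ 2)) • u := by
  ext <;> simp [cmul, dotp, rot] <;> ring

lemma eq_zero_of_cmul_vel_eq_zero {k : ℝ} (hk : 1 < k) {t : ℝ} {b : ℝ × ℝ}
    (h : cmul (vel k t) b = 0) : b = 0 := by
  have h1 := congrArg Prod.fst h
  have h2 := congrArg Prod.snd h
  simp only [cmul, vel, Prod.fst_zero, Prod.snd_zero] at h1 h2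
  have hn := velocity_normSq hk t
  ext
  · simp only [Prod.fst_zero]
    linear_combination (k - sin t) ^ 2 * (velX k t * h1 + velY k t * h2) - b.1 * hn
  · simp only [Prod.snd_zero]
    linear_combination (k - sin t) ^ 2 * (velX k t * h2 - velY k t * h1) - b.2 * hn

lemma Jop_sub {k : ℝ} (hk : 1 < k) {φ ψ : ℝ → ℝ × ℝ} (hφ : ContDiff ℝ 2 φ)
    (hψ : ContDiff ℝ 2 ψ) (t : ℝ) : Jop k (fun t => φ t - ψ t) t = Jop k φ t - Jop k ψ t := by
  have d1 : deriv (fun t => φ t - ψ t) = fun t => deriv φ t - deriv ψ t :=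
    funext fun t => ((hφ.hasDerivAt_deriv t).sub (hψ.hasDerivAt_deriv t)).deriv
  have d2 : deriv (fun t => deriv φ t - deriv ψ t) t = deriv (deriv φ) t - deriv (deriv ψ) t :=
    ((hφ.hasDerivAt_deriv_deriv t).sub (hψ.hasDerivAt_deriv_deriv t)).deriv
  have hc : ∀ {χ : ℝ → ℝ × ℝ}, ContDiff ℝ 2 χ → IntervalIntegrable
      (fun s => dotp (χ s) (rot (vel k s)) / (om k s).2 ^ 2) volume 0 (2 * π) := fun {χ} hχ => by
    have ho := (contDiff_om hk).continuous
    exact ((hχ.dotp (contDiff_vel hk).rot).continuous.div ((continuous_snd.comp ho).pow 2) fun s =>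
      pow_ne_zero 2 (om_snd_pos hk s).ne').intervalIntegrable _ _
  have hI : (∫ s in (0:ℝ)..(2 * π), dotp (φ s - ψ s) (rot (vel k s)) / (om k s).2 ^ 2) =
      (∫ s in (0:ℝ)..(2 * π), dotp (φ s) (rot (vel k s)) / (om k s).2 ^ 2) -
      ∫ s in (0:ℝ)..(2 * π), dotp (ψ s) (rot (vel k s)) / (om k s).2 ^ 2 := by
    rw [← intervalIntegral.integral_sub (hc hφ) (hc hψ)]
    congr 1
    ext s
    simp only [dotp, Prod.fst_sub, Prod.snd_sub]
    ring
  unfold Jop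
  simp only [deriv_om hk]
  rw [hI, d1, d2]
  ext <;> simp [rot, Gam, Gam'] <;> ring

lemma integral_dotp_sub {φ ψ w : ℝ → ℝ × ℝ} (hφ : Continuous φ) (hψ : Continuous ψ)
    (hw : Continuous w) :
    (∫ t in (0:ℝ)..(2 * π), dotp (φ t - ψ t) (w t)) =
      (∫ t in (0:ℝ)..(2 * π), dotp (φ t) (w t)) - ∫ t in (0:ℝ)..(2 * π), dotp (ψ t) (w t) := by
  rw [← intervalIntegral.integral_sub ((hφ.dotp hw).intervalIntegrable _ _)
    ((hψ.dotp hw).intervalIntegrable _ _)]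
  congr 1
  ext s
  simp only [dotp, Prod.fst_sub, Prod.snd_sub]
  ring

/-- The functions `ω'`, `e₁` and `ω` are pairwise orthogonal in `L²` and nonzero. -/
lemma exists_pairing_kernel {k : ℝ} (hk : 1 < k) : ∃ A B : ℝ, A ≠ 0 ∧ B ≠ 0 ∧ ∀ x y z : ℝ,
    (∫ t in (0:ℝ)..(2 * π),
      dotp (x • vel k t + y • ((1:ℝ), (0:ℝ)) + z • om k t) (vel k t)) = x * A ∧
    (∫ t in (0:ℝ)..(2 * π),
      dotp (x • vel k t + y • ((1:ℝ), (0:ℝ)) + z • om k t) ((1:ℝ), (0:ℝ))) = y * (2 * π) ∧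
    (∫ t in (0:ℝ)..(2 * π),
      dotp (x • vel k t + y • ((1:ℝ), (0:ℝ)) + z • om k t) (om k t)) = z * B := by
  have cv := (contDiff_vel hk).continuous
  have co := (contDiff_om hk).continuous
  have ce : Continuous fun _ : ℝ => ((1:ℝ), (0:ℝ)) := continuous_const
  have hve : (∫ t in (0:ℝ)..(2 * π), dotp (vel k t) ((1:ℝ), (0:ℝ))) = 0 :=
    integral_eq_zero_of_hasDerivAt_periodic (F := fun t => (om k t).1)
      (fun t => (hasDerivAt_om hk t).fst_comp.congr_deriv (by simp [dotp]))
      (cv.dotp ce) (fun t => by simp only [om_periodic k t])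
  have hvo : (∫ t in (0:ℝ)..(2 * π), dotp (vel k t) (om k t)) = 0 :=
    integral_eq_zero_of_hasDerivAt_periodic
      (F := fun t => ((om k t).1 ^ 2 + (om k t).2 ^ 2) / 2)
      (fun t => ((((hasDerivAt_om hk t).fst_comp.pow 2).add
        ((hasDerivAt_om hk t).snd_comp.pow 2)).div_const 2).congr_deriv (by
          simp only [dotp]; ring))
      (cv.dotp co) (fun t => by simp only [om_periodic k t])
  have heo : (∫ t in (0:ℝ)..(2 * π), dotp ((1:ℝ), (0:ℝ)) (om k t)) = 0 :=
    integral_eq_zero_of_hasDerivAt_periodic (F := fun t => -log (k - sin t))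
      (fun t => ((((hasDerivAt_sin t).const_sub k).log
        (sub_sin_pos hk t).ne').neg).congr_deriv (by simp only [dotp, om]; ring))
      (ce.dotp co) (fun t => by simp only [sin_periodic t])
  have hcomm : ∀ a b, dotp a b = dotp b a := fun a b => by simp only [dotp]; ring
  have hlin : ∀ {w : ℝ → ℝ × ℝ}, Continuous w → ∀ x y z : ℝ, (∫ t in (0:ℝ)..(2 * π),
      dotp (x • vel k t + y • ((1:ℝ), (0:ℝ)) + z • om k t) (w t)) =
      x * (∫ t in (0:ℝ)..(2 * π), dotp (vel k t) (w t))
      + y * (∫ t in (0:ℝ)..(2 * π), dotp ((1:ℝ), (0:ℝ)) (w t))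
      + z * ∫ t in (0:ℝ)..(2 * π), dotp (om k t) (w t) := fun {w} cw x y z => by
    have c1 := cv.dotp cw
    have c2 := ce.dotp cw
    have c3 := co.dotp cw
    rw [← intervalIntegral.integral_const_mul, ← intervalIntegral.integral_const_mul,
      ← intervalIntegral.integral_const_mul, ← intervalIntegral.integral_add,
      ← intervalIntegral.integral_add]
    · congr 1
      ext s
      simp [dotp]
      ring
    all_goals apply Continuous.intervalIntegrable; fun_prop
  have hpi : (0:ℝ) < 2 * π := by positivity
  refine ⟨∫ t in (0:ℝ)..(2 * π), dotp (vel k t) (vel k t),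
    ∫ t in (0:ℝ)..(2 * π), dotp (om k t) (om k t), ne_of_gt ?_, ne_of_gt ?_, fun x y z =>
    ⟨?_, ?_, ?_⟩⟩
  · refine intervalIntegral.intervalIntegral_pos_of_pos
      ((cv.dotp cv).intervalIntegrable _ _) (fun t => ?_) hpi
    have h := velocity_normSq hk t
    have h2 := pow_pos (sub_sin_pos hk t) 2
    have : 0 < velX k t ^ 2 + velY k t ^ 2 := by
      by_contra hc
      nlinarith
    simpa only [dotp, vel, sq] using this
  · refine intervalIntegral.intervalIntegral_pos_of_pos
      ((co.dotp co).intervalIntegrable _ _) (fun t => ?_) hpi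
    have := om_snd_pos hk t
    simp only [dotp]
    nlinarith [mul_self_nonneg (om k t).1]
  · rw [hlin cv]
    simp only [hcomm _ (vel k _), hve, hvo]
    ring
  · rw [hlin ce, hve]
    simp only [hcomm (om k _), heo]
    simp [dotp]
  · rw [hlin co, hvo, heo]
    ring

lemma exists_Jop_eq {k : ℝ} (hk : 1 < k) {v : ℝ → ℝ × ℝ} (hv : Continuous v)
    (hvper : Function.Periodic v (2 * π))
    (hv1 : (∫ t in (0:ℝ)..(2 * π), dotp (v t) (vel k t)) = 0)
    (hv2 : (∫ t in (0:ℝ)..(2 * π), dotp (v t) ((1:ℝ), (0:ℝ))) = 0)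
    (hv3 : (∫ t in (0:ℝ)..(2 * π), dotp (v t) (om k t)) = 0) :
    ∃ φ : ℝ → ℝ × ℝ, ContDiff ℝ 2 φ ∧ Function.Periodic φ (2 * π) ∧
      ∀ t, Jop k φ t = (om k t).2 ^ 2 • v t := by
  have hR := (Rk_pos hk).ne'
  have cv := (contDiff_vel hk).continuous
  have cr := (contDiff_vel hk).rot.continuous
  have co := (contDiff_om hk).continuous
  have ce : Continuous fun _ : ℝ => ((1:ℝ), (0:ℝ)) := continuous_const
  have he : ∀ t, dotp (v t) ((1:ℝ), (0:ℝ)) = (1 - k * sin t) * dotp (v t) (vel k t)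
      - cos t / Rk k * dotp (v t) (rot (vel k t)) := fun t => by
    have h : cmul (vel k t) (kerB k 0 1 0 t) = ((1:ℝ), (0:ℝ)) := by
      simp [cmul_vel_kerB hk]
    rw [← h, dotp_cmul]
    simp only [kerB]
    ring
  have ho : ∀ t, dotp (v t) (om k t) = k * cos t * dotp (v t) (vel k t)
      - sin t / Rk k * dotp (v t) (rot (vel k t)) := fun t => by
    have h : cmul (vel k t) (kerB k 0 0 1 t) = om k t := by
      simp [cmul_vel_kerB hk]
    rw [← h, dotp_cmul]
    simp only [kerB]
    ring
  obtain ⟨g, hg, hgp, hB⟩ := exists_Bop_eq hk (f := fun t => ((Rk k ^ 2)⁻¹ * dotp (v t) (vel k t),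
      (Rk k ^ 2)⁻¹ * dotp (v t) (rot (vel k t))))
    ((continuous_const.mul (hv.dotp cv)).prodMk (continuous_const.mul (hv.dotp cr)))
    (fun t => by simp only [hvper t, vel_periodic k t])
    (by rw [intervalIntegral.integral_const_mul, hv1, mul_zero])
    (by
      have : ∀ t, (Rk k ^ 2)⁻¹ * dotp (v t) (rot (vel k t)) * cos t
          + k * Rk k * ((Rk k ^ 2)⁻¹ * dotp (v t) (vel k t) * sin t) =
          (Rk k)⁻¹ * (dotp (v t) (vel k t) - dotp (v t) ((1:ℝ), (0:ℝ))) := fun t => by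
        rw [he]
        field_simp
        ring
      simp only [this]
      rw [intervalIntegral.integral_const_mul, intervalIntegral.integral_sub
        ((hv.dotp cv).intervalIntegrable _ _) ((hv.dotp ce).intervalIntegrable _ _), hv1, hv2]
      simp)
    (by
      have : ∀ t, (Rk k ^ 2)⁻¹ * dotp (v t) (rot (vel k t)) * sin t
          - k * Rk k * ((Rk k ^ 2)⁻¹ * dotp (v t) (vel k t) * cos t) =
          -(Rk k)⁻¹ * dotp (v t) (om k t) := fun t => by
        rw [ho]
        field_simp
        ring
      simp only [this]
      rw [intervalIntegral.integral_const_mul, hv3, mul_zero])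
  refine ⟨fun t => cmul (vel k t) (g t), (contDiff_vel hk).cmul hg,
    fun t => by simp only [hgp t, vel_periodic k t], fun t => ?_⟩
  rw [Jop_cmul_vel hk hg, hB, cmul_dotp_rot]
  congr 1
  have hs := (sub_sin_pos hk t).ne'
  have hn := velocity_normSq hk t
  simp only [om, vel]
  field_simp
  linear_combination hn

lemma exists_eq_of_Jop_eq_zero {k : ℝ} (hk : 1 < k) {φ : ℝ → ℝ × ℝ} (hφ : ContDiff ℝ 2 φ)
    (hp : Function.Periodic φ (2 * π)) (h0 : ∀ t, Jop k φ t = 0) :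
    ∃ x y z : ℝ, ∀ t, φ t = x • vel k t + y • ((1:ℝ), (0:ℝ)) + z • om k t := by
  set g : ℝ → ℝ × ℝ := fun t => ((k - sin t) ^ 2 * dotp (φ t) (vel k t),
    (k - sin t) ^ 2 * dotp (φ t) (rot (vel k t))) with hgdef
  have hφg : ∀ t, cmul (vel k t) (g t) = φ t := fun t => by
    rw [hgdef, cmul_dotp_rot]
    simp only [vel, velocity_normSq hk, one_smul]
  have hs : ContDiff ℝ 2 fun t => (k - sin t) ^ 2 := by fun_prop
  have hg : ContDiff ℝ 2 g := (hs.mul (hφ.dotp (contDiff_vel hk))).prodMk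
    (hs.mul (hφ.dotp (contDiff_vel hk).rot))
  obtain ⟨x, y, z, h⟩ := exists_eq_kerB hk hg
    (fun t => by simp only [hgdef, hp t, vel_periodic k t, sin_periodic t])
    (fun t => eq_zero_of_cmul_vel_eq_zero hk (by
      rw [← Jop_cmul_vel hk hg]
      simp only [hφg, h0]))
  exact ⟨x, y, z, fun t => by rw [← hφg, h, cmul_vel_kerB hk]⟩

/-- for every continuous `2π`-periodic `v` orthogonal in `L²` to
`ω'`, `e₁`, `ω`, there is a unique C² `2π`-periodic `φ` with the same orthogonality
properties solving `ω₂⁻²𝓙(φ) = v`. -/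
theorem stmt_11 (k : ℝ) (hk : 1 < k) (v : ℝ → ℝ × ℝ)
    (hv : Continuous v) (hvper : Function.Periodic v (2 * π))
    (hv1 : (∫ t in (0:ℝ)..(2 * π), dotp (v t) (deriv (om k) t)) = 0)
    (hv2 : (∫ t in (0:ℝ)..(2 * π), dotp (v t) (((1:ℝ), (0:ℝ)) : ℝ × ℝ)) = 0)
    (hv3 : (∫ t in (0:ℝ)..(2 * π), dotp (v t) (om k t)) = 0) :
    ∃! φ : ℝ → ℝ × ℝ,
      ContDiff ℝ 2 φ ∧ Function.Periodic φ (2 * π) ∧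
      (∫ t in (0:ℝ)..(2 * π), dotp (φ t) (deriv (om k) t)) = 0 ∧
      (∫ t in (0:ℝ)..(2 * π), dotp (φ t) (((1:ℝ), (0:ℝ)) : ℝ × ℝ)) = 0 ∧
      (∫ t in (0:ℝ)..(2 * π), dotp (φ t) (om k t)) = 0 ∧
      ∀ t : ℝ, ((om k t).2 ^ 2)⁻¹ • Jop k φ t = v t := by
  have cv := (contDiff_vel hk).continuous
  have co := (contDiff_om hk).continuous
  have ce : Continuous fun _ : ℝ => ((1:ℝ), (0:ℝ)) := continuous_const
  have hw : ∀ t, (om k t).2 ^ 2 ≠ 0 := fun t => pow_ne_zero 2 (om_snd_pos hk t).ne'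
  simp only [deriv_om hk] at hv1 ⊢
  simp only [inv_smul_eq_iff₀ (hw _)]
  obtain ⟨A, B, hA, hB, hker⟩ := exists_pairing_kernel hk
  have hpi : 2 * π ≠ 0 := by positivity
  refine existsUnique_of_exists_of_unique ?_ ?_
  · obtain ⟨φ, hφ, hφp, hφJ⟩ := exists_Jop_eq hk hv hvper hv1 hv2 hv3
    set x := (∫ t in (0:ℝ)..(2 * π), dotp (φ t) (vel k t)) / A with hx
    set y := (∫ t in (0:ℝ)..(2 * π), dotp (φ t) ((1:ℝ), (0:ℝ))) / (2 * π) with hy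
    set z := (∫ t in (0:ℝ)..(2 * π), dotp (φ t) (om k t)) / B with hz
    set u : ℝ → ℝ × ℝ := fun t => x • vel k t + y • ((1:ℝ), (0:ℝ)) + z • om k t with hu
    have hue : u = fun t => cmul (vel k t) (kerB k x y z t) :=
      funext fun t => (cmul_vel_kerB hk x y z t).symm
    have huC : ContDiff ℝ 2 u := hue ▸ (contDiff_vel hk).cmul (contDiff_kerB k x y z)
    have huJ : ∀ t, Jop k u t = 0 := fun t => by
      rw [hue, Jop_cmul_vel hk (contDiff_kerB k x y z), Bop_kerB hk]
      simp [cmul]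
    obtain ⟨k1, k2, k3⟩ := hker x y z
    refine ⟨fun t => φ t - u t, hφ.sub huC, fun t => ?_, ?_, ?_, ?_, fun t => ?_⟩
    · simp only [hu, hφp t, vel_periodic k t, om_periodic k t]
    · rw [integral_dotp_sub hφ.continuous huC.continuous cv, k1, hx, div_mul_cancel₀ _ hA, sub_self]
    · rw [integral_dotp_sub hφ.continuous huC.continuous ce, k2, hy, div_mul_cancel₀ _ hpi,
        sub_self]
    · rw [integral_dotp_sub hφ.continuous huC.continuous co, k3, hz, div_mul_cancel₀ _ hB, sub_self]
    · rw [Jop_sub hk hφ huC, huJ, hφJ, sub_zero]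
  · rintro φ ψ ⟨hφ, hφp, a1, a2, a3, hφJ⟩ ⟨hψ, hψp, b1, b2, b3, hψJ⟩
    obtain ⟨x, y, z, h⟩ := exists_eq_of_Jop_eq_zero hk (hφ.sub hψ)
      (fun t => by simp only [hφp t, hψp t])
      (fun t => by rw [Jop_sub hk hφ hψ, hφJ, hψJ, sub_self])
    have i1 := integral_dotp_sub hφ.continuous hψ.continuous cv
    have i2 := integral_dotp_sub hφ.continuous hψ.continuous ce
    have i3 := integral_dotp_sub hφ.continuous hψ.continuous co
    obtain ⟨k1, k2, k3⟩ := hker x y z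
    simp only [h] at i1 i2 i3
    rw [a1, b1, sub_self, k1] at i1
    rw [a2, b2, sub_self, k2] at i2
    rw [a3, b3, sub_self, k3] at i3
    have hx := (mul_eq_zero.1 i1).resolve_right hA
    have hy := (mul_eq_zero.1 i2).resolve_right hpi
    have hz := (mul_eq_zero.1 i3).resolve_right hB
    exact funext fun t => sub_eq_zero.1 ((h t).trans (by simp [hx, hy, hz]))
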